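/- The fifteen tetrahedra Q1,...,Q15 partition {1,...,60}, each of the fifteen quartic polynomials Qprod_i := product over j in Q_i of ell_j (a product of four of the sixty reflection-hyperplane linear forms) lies in the C-linear span of the five quartics q0, q1, q2, q3, q4, and together the fifteen products Qprod_1,...,Qprod_15 span that 5-dimensional space; in other words the space U5 contains 15 products of 4 reflection hyperplanes, is generated by them, and these products split the 60 reflection hyperplanes into 15 tetrahedra. -/

import Mathlib

/-- `II` denotes the constant `i` (a square root of `-1`) in `ℂ[a1, a2, a3, a4]`. -/
noncomputable def II : MvPolynomial (Fin 4) ℂ := MvPolynomial.C Complex.I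

set_option maxHeartbeats 2000000 in
/-- The sixty linear equations of the reflection hyperplanes of the complex reflection group
`G₃₁`, as linear forms in `ℂ[a1, a2, a3, a4]` (variables `X 0, X 1, X 2, X 3`). -/
noncomputable def ell : ℕ → MvPolynomial (Fin 4) ℂ
  | 1 => MvPolynomial.X 0
  | 2 => MvPolynomial.X 1
  | 3 => MvPolynomial.X 2
  | 4 => MvPolynomial.X 3
  | 5 => MvPolynomial.X 0 + MvPolynomial.X 1
  | 6 => MvPolynomial.X 0 + (-1 : MvPolynomial (Fin 4) ℂ) * MvPolynomial.X 1
  | 7 => MvPolynomial.X 2 + MvPolynomial.X 3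
  | 8 => MvPolynomial.X 2 + (-1 : MvPolynomial (Fin 4) ℂ) * MvPolynomial.X 3
  | 9 => MvPolynomial.X 0 + (II) * MvPolynomial.X 1
  | 10 => MvPolynomial.X 0 + (-II) * MvPolynomial.X 1
  | 11 => MvPolynomial.X 2 + (II) * MvPolynomial.X 3
  | 12 => MvPolynomial.X 2 + (-II) * MvPolynomial.X 3
  | 13 => MvPolynomial.X 0 + (II) * MvPolynomial.X 1 + (II+1) * MvPolynomial.X 2
  | 14 => MvPolynomial.X 0 + (II) * MvPolynomial.X 1 + (II-1) * MvPolynomial.X 2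
  | 15 => MvPolynomial.X 0 + (II) * MvPolynomial.X 1 + (-II+1) * MvPolynomial.X 2
  | 16 => MvPolynomial.X 0 + (II) * MvPolynomial.X 1 + (-II-1) * MvPolynomial.X 2
  | 17 => MvPolynomial.X 0 + (-II) * MvPolynomial.X 1 + (II+1) * MvPolynomial.X 2
  | 18 => MvPolynomial.X 0 + (-II) * MvPolynomial.X 1 + (II-1) * MvPolynomial.X 2
  | 19 => MvPolynomial.X 0 + (-II) * MvPolynomial.X 1 + (-II+1) * MvPolynomial.X 2
  | 20 => MvPolynomial.X 0 + (-II) * MvPolynomial.X 1 + (-II-1) * MvPolynomial.X 2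
  | 21 => MvPolynomial.X 0 + (II) * MvPolynomial.X 1 + (II+1) * MvPolynomial.X 3
  | 22 => MvPolynomial.X 0 + (II) * MvPolynomial.X 1 + (II-1) * MvPolynomial.X 3
  | 23 => MvPolynomial.X 0 + (II) * MvPolynomial.X 1 + (-II+1) * MvPolynomial.X 3
  | 24 => MvPolynomial.X 0 + (II) * MvPolynomial.X 1 + (-II-1) * MvPolynomial.X 3
  | 25 => MvPolynomial.X 0 + (-II) * MvPolynomial.X 1 + (II+1) * MvPolynomial.X 3
  | 26 => MvPolynomial.X 0 + (-II) * MvPolynomial.X 1 + (II-1) * MvPolynomial.X 3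
  | 27 => MvPolynomial.X 0 + (-II) * MvPolynomial.X 1 + (-II+1) * MvPolynomial.X 3
  | 28 => MvPolynomial.X 0 + (-II) * MvPolynomial.X 1 + (-II-1) * MvPolynomial.X 3
  | 29 => MvPolynomial.X 0 + MvPolynomial.X 1 + MvPolynomial.X 2 + MvPolynomial.X 3
  | 30 => MvPolynomial.X 0 + (-1 : MvPolynomial (Fin 4) ℂ) * MvPolynomial.X 1 + MvPolynomial.X 2 + MvPolynomial.X 3
  | 31 => MvPolynomial.X 0 + MvPolynomial.X 1 + (-1 : MvPolynomial (Fin 4) ℂ) * MvPolynomial.X 2 + MvPolynomial.X 3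
  | 32 => MvPolynomial.X 0 + MvPolynomial.X 1 + MvPolynomial.X 2 + (-1 : MvPolynomial (Fin 4) ℂ) * MvPolynomial.X 3
  | 33 => MvPolynomial.X 0 + (-1 : MvPolynomial (Fin 4) ℂ) * MvPolynomial.X 1 + (-1 : MvPolynomial (Fin 4) ℂ) * MvPolynomial.X 2 + MvPolynomial.X 3
  | 34 => MvPolynomial.X 0 + (-1 : MvPolynomial (Fin 4) ℂ) * MvPolynomial.X 1 + MvPolynomial.X 2 + (-1 : MvPolynomial (Fin 4) ℂ) * MvPolynomial.X 3
  | 35 => MvPolynomial.X 0 + MvPolynomial.X 1 + (-1 : MvPolynomial (Fin 4) ℂ) * MvPolynomial.X 2 + (-1 : MvPolynomial (Fin 4) ℂ) * MvPolynomial.X 3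
  | 36 => MvPolynomial.X 0 + (-1 : MvPolynomial (Fin 4) ℂ) * MvPolynomial.X 1 + (-1 : MvPolynomial (Fin 4) ℂ) * MvPolynomial.X 2 + (-1 : MvPolynomial (Fin 4) ℂ) * MvPolynomial.X 3
  | 37 => MvPolynomial.X 0 + MvPolynomial.X 1 + (II) * MvPolynomial.X 2 + (II) * MvPolynomial.X 3
  | 38 => MvPolynomial.X 0 + (-1 : MvPolynomial (Fin 4) ℂ) * MvPolynomial.X 1 + (II) * MvPolynomial.X 2 + (II) * MvPolynomial.X 3
  | 39 => MvPolynomial.X 0 + MvPolynomial.X 1 + (-II) * MvPolynomial.X 2 + (II) * MvPolynomial.X 3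
  | 40 => MvPolynomial.X 0 + MvPolynomial.X 1 + (II) * MvPolynomial.X 2 + (-II) * MvPolynomial.X 3
  | 41 => MvPolynomial.X 0 + (-1 : MvPolynomial (Fin 4) ℂ) * MvPolynomial.X 1 + (-II) * MvPolynomial.X 2 + (II) * MvPolynomial.X 3
  | 42 => MvPolynomial.X 0 + (-1 : MvPolynomial (Fin 4) ℂ) * MvPolynomial.X 1 + (II) * MvPolynomial.X 2 + (-II) * MvPolynomial.X 3
  | 43 => MvPolynomial.X 0 + MvPolynomial.X 1 + (-II) * MvPolynomial.X 2 + (-II) * MvPolynomial.X 3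
  | 44 => MvPolynomial.X 0 + (-1 : MvPolynomial (Fin 4) ℂ) * MvPolynomial.X 1 + (-II) * MvPolynomial.X 2 + (-II) * MvPolynomial.X 3
  | 45 => (II+1) * MvPolynomial.X 0 + (II) * MvPolynomial.X 2 + (-1 : MvPolynomial (Fin 4) ℂ) * MvPolynomial.X 3
  | 46 => (II+1) * MvPolynomial.X 0 + (II) * MvPolynomial.X 2 + MvPolynomial.X 3
  | 47 => (II-1) * MvPolynomial.X 0 + (-II) * MvPolynomial.X 2 + (-1 : MvPolynomial (Fin 4) ℂ) * MvPolynomial.X 3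
  | 48 => (II-1) * MvPolynomial.X 0 + (-II) * MvPolynomial.X 2 + MvPolynomial.X 3
  | 49 => (II-1) * MvPolynomial.X 0 + (II) * MvPolynomial.X 2 + (-1 : MvPolynomial (Fin 4) ℂ) * MvPolynomial.X 3
  | 50 => (II-1) * MvPolynomial.X 0 + (II) * MvPolynomial.X 2 + MvPolynomial.X 3
  | 51 => (II+1) * MvPolynomial.X 0 + (-II) * MvPolynomial.X 2 + (-1 : MvPolynomial (Fin 4) ℂ) * MvPolynomial.X 3
  | 52 => (II+1) * MvPolynomial.X 0 + (-II) * MvPolynomial.X 2 + MvPolynomial.X 3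
  | 53 => (II+1) * MvPolynomial.X 1 + (II) * MvPolynomial.X 2 + (-1 : MvPolynomial (Fin 4) ℂ) * MvPolynomial.X 3
  | 54 => (II+1) * MvPolynomial.X 1 + (II) * MvPolynomial.X 2 + MvPolynomial.X 3
  | 55 => (II-1) * MvPolynomial.X 1 + (-II) * MvPolynomial.X 2 + (-1 : MvPolynomial (Fin 4) ℂ) * MvPolynomial.X 3
  | 56 => (II-1) * MvPolynomial.X 1 + (-II) * MvPolynomial.X 2 + MvPolynomial.X 3
  | 57 => (II-1) * MvPolynomial.X 1 + (II) * MvPolynomial.X 2 + (-1 : MvPolynomial (Fin 4) ℂ) * MvPolynomial.X 3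
  | 58 => (II-1) * MvPolynomial.X 1 + (II) * MvPolynomial.X 2 + MvPolynomial.X 3
  | 59 => (II+1) * MvPolynomial.X 1 + (-II) * MvPolynomial.X 2 + (-1 : MvPolynomial (Fin 4) ℂ) * MvPolynomial.X 3
  | 60 => (II+1) * MvPolynomial.X 1 + (-II) * MvPolynomial.X 2 + MvPolynomial.X 3
  | _ => 0

/-- The fifteen tetrahedra: 4-element subsets of `{1, …, 60}` indexing the reflection
hyperplanes occurring in each of the fifteen quartic products. -/
def Qtet : ℕ → Finset ℕ
  | 1 => {1,2,11,12}
  | 2 => {3,4,9,10}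
  | 3 => {5,6,7,8}
  | 4 => {48,49,54,59}
  | 5 => {45,52,55,58}
  | 6 => {47,50,53,60}
  | 7 => {46,51,56,57}
  | 8 => {14,15,25,28}
  | 9 => {13,16,26,27}
  | 10 => {18,19,21,24}
  | 11 => {17,20,22,23}
  | 12 => {33,34,37,43}
  | 13 => {29,35,41,42}
  | 14 => {31,32,38,44}
  | 15 => {30,36,39,40}
  | _ => ∅

/-- The quartic product of the reflection-hyperplane linear forms of the `i`-th tetrahedron. -/
noncomputable def Qprod (i : ℕ) : MvPolynomial (Fin 4) ℂ := ∏ j ∈ Qtet i, ell j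

/-- The basis quartics of the space `U₅` of quadratic complexes coming from the Cartan
subspace. -/
noncomputable def q0 : MvPolynomial (Fin 4) ℂ :=
  (MvPolynomial.X 0 ^ 2 - MvPolynomial.X 1 ^ 2) * (MvPolynomial.X 2 ^ 2 - MvPolynomial.X 3 ^ 2)
noncomputable def q1 : MvPolynomial (Fin 4) ℂ :=
  (MvPolynomial.X 0 ^ 2 + MvPolynomial.X 1 ^ 2) * MvPolynomial.X 2 * MvPolynomial.X 3
noncomputable def q2 : MvPolynomial (Fin 4) ℂ :=
  MvPolynomial.X 0 * MvPolynomial.X 1 * (MvPolynomial.X 2 ^ 2 + MvPolynomial.X 3 ^ 2)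
noncomputable def q3 : MvPolynomial (Fin 4) ℂ :=
  2 * MvPolynomial.X 0 ^ 4 + 2 * MvPolynomial.X 1 ^ 4 - MvPolynomial.X 2 ^ 4
    - MvPolynomial.X 3 ^ 4 + 6 * MvPolynomial.X 2 ^ 2 * MvPolynomial.X 3 ^ 2
noncomputable def q4 : MvPolynomial (Fin 4) ℂ :=
  2 * MvPolynomial.X 2 ^ 4 + 2 * MvPolynomial.X 3 ^ 4 - MvPolynomial.X 0 ^ 4
    - MvPolynomial.X 1 ^ 4 + 6 * MvPolynomial.X 0 ^ 2 * MvPolynomial.X 1 ^ 2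

theorem II_sq : II ^ 2 = -1 := by
  rw [II, ← map_pow, Complex.I_sq, map_neg, map_one]

theorem Qprod_one : Qprod 1 = q2 := by
  simp [Qprod, Qtet, ell, q2]
  grind [II_sq]

theorem Qprod_two : Qprod 2 = q1 := by
  simp [Qprod, Qtet, ell, q1]
  grind [II_sq]

theorem Qprod_three : Qprod 3 = q0 := by
  simp [Qprod, Qtet, ell, q0]
  ring

theorem three_mul_Qprod_four : 3 * Qprod 4 = -6 * II * q0 - 12 * q1 + q3 + 2 * q4 := by
  simp [Qprod, Qtet, ell, q0, q1, q3, q4]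
  grind [II_sq]

theorem three_mul_Qprod_five : 3 * Qprod 5 = 6 * II * q0 + 12 * q1 + q3 + 2 * q4 := by
  simp [Qprod, Qtet, ell, q0, q1, q3, q4]
  grind [II_sq]

theorem three_mul_Qprod_six : 3 * Qprod 6 = -6 * II * q0 + 12 * q1 + q3 + 2 * q4 := by
  simp [Qprod, Qtet, ell, q0, q1, q3, q4]
  grind [II_sq]

theorem three_mul_Qprod_seven : 3 * Qprod 7 = 6 * II * q0 - 12 * q1 + q3 + 2 * q4 := by
  simp [Qprod, Qtet, ell, q0, q1, q3, q4]
  grind [II_sq]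

theorem three_mul_Qprod_eight : 3 * Qprod 8 = 6 * II * q0 + 12 * q2 + 2 * q3 + q4 := by
  simp [Qprod, Qtet, ell, q0, q2, q3, q4]
  grind [II_sq]

theorem three_mul_Qprod_nine : 3 * Qprod 9 = -6 * II * q0 - 12 * q2 + 2 * q3 + q4 := by
  simp [Qprod, Qtet, ell, q0, q2, q3, q4]
  grind [II_sq]

theorem three_mul_Qprod_ten : 3 * Qprod 10 = 6 * II * q0 - 12 * q2 + 2 * q3 + q4 := by
  simp [Qprod, Qtet, ell, q0, q2, q3, q4]
  grind [II_sq]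

theorem three_mul_Qprod_eleven : 3 * Qprod 11 = -6 * II * q0 + 12 * q2 + 2 * q3 + q4 := by
  simp [Qprod, Qtet, ell, q0, q2, q3, q4]
  grind [II_sq]

theorem three_mul_Qprod_twelve : 3 * Qprod 12 = 12 * q1 - 12 * q2 + q3 - q4 := by
  simp [Qprod, Qtet, ell, q1, q2, q3, q4]
  grind [II_sq]

theorem three_mul_Qprod_thirteen : 3 * Qprod 13 = -12 * q1 + 12 * q2 + q3 - q4 := by
  simp [Qprod, Qtet, ell, q1, q2, q3, q4]
  grind [II_sq]

theorem three_mul_Qprod_fourteen : 3 * Qprod 14 = 12 * q1 + 12 * q2 + q3 - q4 := by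
  simp [Qprod, Qtet, ell, q1, q2, q3, q4]
  grind [II_sq]

theorem three_mul_Qprod_fifteen : 3 * Qprod 15 = -12 * q1 - 12 * q2 + q3 - q4 := by
  simp [Qprod, Qtet, ell, q1, q2, q3, q4]
  grind [II_sq]

/-- A polynomial is in `U₅` as soon as its triple is a combination of the basis quartics. -/
theorem mem_span_of_three_mul_eq {p : MvPolynomial (Fin 4) ℂ} (c₀ c₁ c₂ c₃ c₄ : ℤ)
    (h : 3 * p = c₀ * (II * q0) + c₁ * q1 + c₂ * q2 + c₃ * q3 + c₄ * q4) :
    p ∈ Submodule.span ℂ ({q0, q1, q2, q3, q4} : Set (MvPolynomial (Fin 4) ℂ)) := by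
  have hp : p = (3⁻¹ : ℂ) •
      (c₀ • Complex.I • q0 + c₁ • q1 + c₂ • q2 + c₃ • q3 + c₄ • q4) := by
    simp only [zsmul_eq_mul, MvPolynomial.smul_eq_C_mul]
    rw [← II, ← h, ← map_ofNat MvPolynomial.C 3, ← mul_assoc, ← map_mul]
    norm_num
  rw [hp]
  refine Submodule.smul_mem _ _ ?_
  refine add_mem (add_mem (add_mem (add_mem ?_ ?_) ?_) ?_) ?_ <;> refine zsmul_mem ?_ _
  · exact Submodule.smul_mem _ _ (Submodule.subset_span (by simp))
  all_goals exact Submodule.subset_span (by simp)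

theorem Qprod_mem_span (i : ℕ) (hi : i ∈ Finset.Icc 1 15) :
    Qprod i ∈ Submodule.span ℂ ({q0, q1, q2, q3, q4} : Set (MvPolynomial (Fin 4) ℂ)) := by
  obtain ⟨h₁, h₂⟩ := Finset.mem_Icc.mp hi
  interval_cases i
  · exact Submodule.subset_span (by simp [Qprod_one])
  · exact Submodule.subset_span (by simp [Qprod_two])
  · exact Submodule.subset_span (by simp [Qprod_three])
  · refine mem_span_of_three_mul_eq (-6) (-12) 0 1 2 ?_
    rw [three_mul_Qprod_four]
    push_cast
    ring
  · refine mem_span_of_three_mul_eq 6 12 0 1 2 ?_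
    rw [three_mul_Qprod_five]
    push_cast
    ring
  · refine mem_span_of_three_mul_eq (-6) 12 0 1 2 ?_
    rw [three_mul_Qprod_six]
    push_cast
    ring
  · refine mem_span_of_three_mul_eq 6 (-12) 0 1 2 ?_
    rw [three_mul_Qprod_seven]
    push_cast
    ring
  · refine mem_span_of_three_mul_eq 6 0 12 2 1 ?_
    rw [three_mul_Qprod_eight]
    push_cast
    ring
  · refine mem_span_of_three_mul_eq (-6) 0 (-12) 2 1 ?_
    rw [three_mul_Qprod_nine]
    push_cast
    ring
  · refine mem_span_of_three_mul_eq 6 0 (-12) 2 1 ?_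
    rw [three_mul_Qprod_ten]
    push_cast
    ring
  · refine mem_span_of_three_mul_eq (-6) 0 12 2 1 ?_
    rw [three_mul_Qprod_eleven]
    push_cast
    ring
  · refine mem_span_of_three_mul_eq 0 12 (-12) 1 (-1) ?_
    rw [three_mul_Qprod_twelve]
    push_cast
    ring
  · refine mem_span_of_three_mul_eq 0 (-12) 12 1 (-1) ?_
    rw [three_mul_Qprod_thirteen]
    push_cast
    ring
  · refine mem_span_of_three_mul_eq 0 12 12 1 (-1) ?_
    rw [three_mul_Qprod_fourteen]
    push_cast
    ring
  · refine mem_span_of_three_mul_eq 0 (-12) (-12) 1 (-1) ?_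
    rw [three_mul_Qprod_fifteen]
    push_cast
    ring

theorem linearIndependent_basis_quartics : LinearIndependent ℂ ![q0, q1, q2, q3, q4] := by
  rw [Fintype.linearIndependent_iff]
  intro g hg
  have key (x : Fin 4 → ℂ) := congrArg (MvPolynomial.eval x) hg
  simp only [Fin.sum_univ_five, q0, q1, q2, q3, q4] at key
  have e₁ := key ![1, 0, 0, 0]
  have e₂ := key ![0, 0, 1, 0]
  have e₃ := key ![1, 0, 1, 0]
  have e₄ := key ![1, 0, 1, 1]
  have e₅ := key ![1, 1, 1, 0]
  simp [MvPolynomial.smul_eval] at e₁ e₂ e₃ e₄ e₅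
  have h₃ : g 3 = 0 := by linear_combination (2 * e₁ + e₂) / 3
  have h₄ : g 4 = 0 := by linear_combination (e₁ + 2 * e₂) / 3
  simp [h₃, h₄] at e₃ e₄ e₅
  intro i
  fin_cases i <;> simp_all

theorem range_basis_quartics :
    Set.range ![q0, q1, q2, q3, q4] = ({q0, q1, q2, q3, q4} : Set (MvPolynomial (Fin 4) ℂ)) := by
  ext p
  simp only [Matrix.range_cons, Matrix.range_empty, Set.mem_union, Set.mem_insert_iff,
    Set.mem_singleton_iff, Set.union_empty]

theorem basis_quartics_subset_span_Qprod :
    ({q0, q1, q2, q3, q4} : Set (MvPolynomial (Fin 4) ℂ)) ⊆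
      Submodule.span ℂ (Qprod '' Set.Icc 1 15) := by
  have mem (i : ℕ) (h₁ : 1 ≤ i) (h₂ : i ≤ 15) :
      Qprod i ∈ Submodule.span ℂ (Qprod '' Set.Icc 1 15) :=
    Submodule.subset_span ⟨i, ⟨h₁, h₂⟩, rfl⟩
  have m₄ := mem 4 (by norm_num) (by norm_num)
  have m₅ := mem 5 (by norm_num) (by norm_num)
  have m₈ := mem 8 (by norm_num) (by norm_num)
  have m₉ := mem 9 (by norm_num) (by norm_num)
  have half : MvPolynomial.C (2⁻¹ : ℂ) * 2 = (1 : MvPolynomial (Fin 4) ℂ) := by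
    rw [← map_ofNat MvPolynomial.C 2, ← map_mul]
    norm_num
  have h₃ : q3 = (Qprod 8 + Qprod 9) - (2⁻¹ : ℂ) • (Qprod 4 + Qprod 5) := by
    rw [MvPolynomial.smul_eq_C_mul]
    grind [three_mul_Qprod_four, three_mul_Qprod_five, three_mul_Qprod_eight,
      three_mul_Qprod_nine]
  have h₄ : q4 = (Qprod 4 + Qprod 5) - (2⁻¹ : ℂ) • (Qprod 8 + Qprod 9) := by
    rw [MvPolynomial.smul_eq_C_mul]
    grind [three_mul_Qprod_four, three_mul_Qprod_five, three_mul_Qprod_eight,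
      three_mul_Qprod_nine]
  rintro p (rfl | rfl | rfl | rfl | rfl)
  · exact Qprod_three ▸ mem 3 (by norm_num) (by norm_num)
  · exact Qprod_two ▸ mem 2 (by norm_num) (by norm_num)
  · exact Qprod_one ▸ mem 1 (by norm_num) (by norm_num)
  · rw [h₃]
    exact sub_mem (add_mem m₈ m₉) (Submodule.smul_mem _ _ (add_mem m₄ m₅))
  · rw [h₄]
    exact sub_mem (add_mem m₄ m₅) (Submodule.smul_mem _ _ (add_mem m₈ m₉))

/-- The space `U₅` contains the 15 products of 4 reflection hyperplanes given by the fifteen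
tetrahedra, it is generated by them, and these products split the 60 reflection hyperplanes
into the 15 tetrahedra. -/
theorem tetrahedra_products_span_U5 :
    (∀ i ∈ Finset.Icc 1 15, ∀ j ∈ Finset.Icc 1 15, i ≠ j → Disjoint (Qtet i) (Qtet j)) ∧
    (Finset.Icc 1 15).biUnion Qtet = Finset.Icc 1 60 ∧
    (∀ i ∈ Finset.Icc 1 15,
      Qprod i ∈ Submodule.span ℂ ({q0, q1, q2, q3, q4} : Set (MvPolynomial (Fin 4) ℂ))) ∧
    Submodule.span ℂ (Qprod '' (Set.Icc 1 15)) =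
      Submodule.span ℂ ({q0, q1, q2, q3, q4} : Set (MvPolynomial (Fin 4) ℂ)) ∧
    Module.finrank ℂ
      ↥(Submodule.span ℂ ({q0, q1, q2, q3, q4} : Set (MvPolynomial (Fin 4) ℂ))) = 5 := by
  refine ⟨by decide, by decide, Qprod_mem_span, le_antisymm ?_ ?_, ?_⟩
  · rw [Submodule.span_le]
    rintro _ ⟨i, hi, rfl⟩
    exact Qprod_mem_span i (Finset.mem_Icc.mpr hi)
  · exact Submodule.span_le.mpr basis_quartics_subset_span_Qprod
  · rw [← range_basis_quartics, finrank_span_eq_card linearIndependent_basis_quartics,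
      Fintype.card_fin]
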